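/- Let (Λ,η) be an isothermic surface in S^n with Christoffel transform (Λ^c,η^c) with respect to a pair (v_∞,v_0). If (Λ,η) is a special isothermic surface of type d ∈ ℕ₀ with respect to a polynomial conserved quantity p(t) whose constant term p(0) lies in ⟨v_∞⟩^⊥, then (Λ^c,η^c) is a special isothermic surface of type d with respect to a polynomial conserved quantity q(t) satisfying (q(t),q(t)) = (p(t),p(t)) as polynomials in t and q(0) ∈ ⟨v_0⟩^⊥. Moreover, if p(0) ∈ ⟨v_∞⟩, then q(0) ∈ ⟨v_0⟩. -/

import Mathlib

noncomputable section

open Finset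

/-- Minkowski space `ℝ^{n+1,1}`, modelled on `Fin (n+2) → ℝ`. -/
abbrev MV (n : ℕ) : Type := EuclideanSpace ℝ (Fin (n + 2))

/-- The Minkowski inner product of signature `(n+1,1)`. -/
def mink (n : ℕ) (x y : MV n) : ℝ :=
  ∑ i : Fin (n + 1), x i.castSucc * y i.castSucc
    - x (Fin.last (n + 1)) * y (Fin.last (n + 1))

/-- The light cone `L ⊂ ℝ^{n+1,1}`. -/
def LightCone (n : ℕ) : Set (MV n) := {v | v ≠ 0 ∧ mink n v v = 0}

/-- The skew endomorphism `u ∧ v`, acting by `(u ∧ v) w = (u,w)v − (v,w)u`. -/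
def wedge (n : ℕ) (u v w : MV n) : MV n :=
  mink n u w • v - mink n v w • u

/-- The surface domain: a two-dimensional coordinate chart. -/
abbrev Surf : Type := ℝ × ℝ

/-- the coordinate direction ∂/∂u -/
def du : Surf := (1, 0)

/-- the coordinate direction ∂/∂v -/
def dv : Surf := (0, 1)

/-- partial derivative of a section in a coordinate direction -/
def pd {n : ℕ} (e : Surf) (f : Surf → MV n) (x : Surf) : MV n :=
  fderiv ℝ f x e

lemma mink_add_left (n : ℕ) (a b c : MV n) :
    mink n (a + b) c = mink n a c + mink n b c := by
  simp [mink, PiLp.add_apply, add_mul, Finset.sum_add_distrib]; ring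

lemma mink_smul_left (n : ℕ) (r : ℝ) (a c : MV n) :
    mink n (r • a) c = r * mink n a c := by
  simp [mink, PiLp.smul_apply, smul_eq_mul, mul_sub, Finset.mul_sum, mul_assoc]

lemma mink_zero_left (n : ℕ) (c : MV n) : mink n 0 c = 0 := by
  simp [mink]

/-- An isothermic surface `(Λ,η)` in `S^n = P(L)`, given by a nowhere-zero null
lift `F` of the immersion `Λ` together with the 1-form
`η = F ∧ W₁ du + F ∧ W₂ dv` with values in `Λ ∧ Λ^⊥`. -/
structure IsothermicSurface (n : ℕ) : Type where
  F : Surf → MV n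
  W₁ : Surf → MV n
  W₂ : Surf → MV n
  smooth_F : ContDiff ℝ (⊤ : ℕ∞) F
  smooth_W₁ : ContDiff ℝ (⊤ : ℕ∞) W₁
  smooth_W₂ : ContDiff ℝ (⊤ : ℕ∞) W₂
  F_ne : ∀ x, F x ≠ 0
  F_null : ∀ x, mink n (F x) (F x) = 0
  immersed : ∀ x, LinearIndependent ℝ ![F x, pd du F x, pd dv F x]
  W₁_perp : ∀ x, mink n (F x) (W₁ x) = 0
  W₂_perp : ∀ x, mink n (F x) (W₂ x) = 0
  eta_ne : ∃ x z, wedge n (F x) (W₁ x) z ≠ 0 ∨ wedge n (F x) (W₂ x) z ≠ 0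
  eta_closed : ∀ x z,
    fderiv ℝ (fun y => wedge n (F y) (W₂ y) z) x du
      = fderiv ℝ (fun y => wedge n (F y) (W₁ y) z) x dv

/-- `s` is a parallel section for the flat connection `∇^t = d + tη`. -/
def ParallelSection (n : ℕ) (S : IsothermicSurface n) (t : ℝ)
    (s : Surf → MV n) : Prop :=
  ∀ x, fderiv ℝ s x du + t • wedge n (S.F x) (S.W₁ x) (s x) = 0
     ∧ fderiv ℝ s x dv + t • wedge n (S.F x) (S.W₂ x) (s x) = 0

/-- A polynomial conserved quantity of degree `d` of the isothermic surface
`(Λ,η)`: a polynomial `p(t) = Σ_{k=0}^d p_k t^k` of (smooth) sections, of exact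
degree `d`, with `∇^t p(t) = 0` for all `t`. -/
structure PolyConservedQuantity (n : ℕ) (S : IsothermicSurface n) (d : ℕ) : Type where
  coeff : ℕ → Surf → MV n
  smooth : ∀ k, ContDiff ℝ (⊤ : ℕ∞) (coeff k)
  coeff_eq_zero : ∀ k, d < k → coeff k = 0
  top_ne : coeff d ≠ 0
  conserved : ∀ t : ℝ, ParallelSection n S t
    (fun x => ∑ k ∈ Finset.range (d + 1), t ^ k • coeff k x)

/-- evaluation `p(t)` of a polynomial conserved quantity -/
def pcEval {n : ℕ} {S : IsothermicSurface n} {d : ℕ}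
    (p : PolyConservedQuantity n S d) (t : ℝ) (x : Surf) : MV n :=
  ∑ k ∈ Finset.range (d + 1), t ^ k • p.coeff k x

/-- `(Λ,η)` is a special isothermic surface of type `d`. -/
def SpecialOfType (n : ℕ) (S : IsothermicSurface n) (d : ℕ) : Prop :=
  Nonempty (PolyConservedQuantity n S d)

/-- `p₀ ∈ ⟨w⟩`: the polynomial conserved quantity exhibits `(Λ,η)` as special
isothermic in the space-form `E(w)`. -/
def InSpaceForm {n : ℕ} {S : IsothermicSurface n} {d : ℕ}
    (p : PolyConservedQuantity n S d) (w : MV n) : Prop :=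
  ∃ c : ℝ, ∀ x, p.coeff 0 x = c • w

/-- fullness: the image of `Λ` lies in no proper subsphere -/
def Full (n : ℕ) (S : IsothermicSurface n) : Prop :=
  ¬ ∃ p : MV n, p ≠ 0 ∧ ∀ x, mink n p (S.F x) = 0
/-- A Darboux transform `Λ̂` of `(Λ,η)` with parameter `m`, given by a
`∇^m`-parallel null lift `G` spanning an immersed surface with `Λ̂ ∩ Λ = 0`. -/
structure DarbouxTransform (n : ℕ) (S : IsothermicSurface n) (m : ℝ) : Type where
  G : Surf → MV n
  smooth_G : ContDiff ℝ (⊤ : ℕ∞) G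
  G_ne : ∀ x, G x ≠ 0
  G_null : ∀ x, mink n (G x) (G x) = 0
  immersed : ∀ x, LinearIndependent ℝ ![G x, pd du G x, pd dv G x]
  disjoint : ∀ x, G x ∉ Submodule.span ℝ {S.F x}
  parallel : ParallelSection n S m G

/-- The gauge transformation `Γ_{⟨F⟩}^{⟨G⟩}(c)`: acts as `c` on `⟨G⟩`, as `1` on
`(⟨F⟩ ⊕ ⟨G⟩)^⊥` and as `c⁻¹` on `⟨F⟩`. -/
def gaugeG (n : ℕ) (F G : MV n) (c : ℝ) (z : MV n) : MV n :=
  ((mink n G z / mink n F G) / c) • F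
    + (c * (mink n F z / mink n F G)) • G
    + (z - (mink n G z / mink n F G) • F - (mink n F z / mink n F G) • G)

/-- `Γ_Λ^{Λ̂}(1 − t/m) · (d + tη) = d + tη̂` for all `t ≠ m`: the gauge relation
between the pencils of flat connections of an isothermic surface `S` and of (an
isothermic structure `T` on) its Darboux transform with parameter `m`. -/
def GaugeRel (n : ℕ) (S T : IsothermicSurface n) (m : ℝ) : Prop :=
  ∀ t : ℝ, t ≠ m → ∀ s : Surf → MV n, ContDiff ℝ (⊤ : ℕ∞) s → ∀ x : Surf,
    (fderiv ℝ (fun y => gaugeG n (S.F y) (T.F y) (1 - t / m) (s y)) x du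
        + t • wedge n (T.F x) (T.W₁ x) (gaugeG n (S.F x) (T.F x) (1 - t / m) (s x))
      = gaugeG n (S.F x) (T.F x) (1 - t / m)
          (fderiv ℝ s x du + t • wedge n (S.F x) (S.W₁ x) (s x)))
    ∧ (fderiv ℝ (fun y => gaugeG n (S.F y) (T.F y) (1 - t / m) (s y)) x dv
        + t • wedge n (T.F x) (T.W₂ x) (gaugeG n (S.F x) (T.F x) (1 - t / m) (s x))
      = gaugeG n (S.F x) (T.F x) (1 - t / m)
          (fderiv ℝ s x dv + t • wedge n (S.F x) (S.W₂ x) (s x)))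

/-- `Λ̂ = ⟨p(m)⟩` with `(p(m),p(m)) = 0`: the Darboux transform `D` is a
complementary surface of `(Λ,η)` with respect to `p(t)`. -/
def IsComplementary (n : ℕ) {S : IsothermicSurface n} {d : ℕ}
    (p : PolyConservedQuantity n S d) {m : ℝ} (D : DarbouxTransform n S m) : Prop :=
  (∀ x, mink n (pcEval p m x) (pcEval p m x) = 0) ∧
  (∀ x, Submodule.span ℝ {D.G x} = Submodule.span ℝ {pcEval p m x})

/-- `m` is a repeated root of the (constant-coefficient) polynomial `(p(t),p(t))`. -/
def IsRepeatedRootAt {n : ℕ} {S : IsothermicSurface n} {d : ℕ}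
    (p : PolyConservedQuantity n S d) (m : ℝ) : Prop :=
  ∀ x, mink n (pcEval p m x) (pcEval p m x) = 0
    ∧ deriv (fun t : ℝ => mink n (pcEval p t x) (pcEval p t x)) m = 0
/-- metric coefficient `g₁₁ = (F_u,F_u)` of the induced metric -/
def gUU (n : ℕ) (F : Surf → MV n) (x : Surf) : ℝ := mink n (pd du F x) (pd du F x)

/-- metric coefficient `g₁₂ = (F_u,F_v)` -/
def gUV (n : ℕ) (F : Surf → MV n) (x : Surf) : ℝ := mink n (pd du F x) (pd dv F x)

/-- metric coefficient `g₂₂ = (F_v,F_v)` -/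
def gVV (n : ℕ) (F : Surf → MV n) (x : Surf) : ℝ := mink n (pd dv F x) (pd dv F x)

/-- `(𝐇, N)`, the inner product of the mean curvature vector of `F` (in a
space-form `E(w)`) with a normal field `N`: half the trace with respect to the
induced metric of the `N`-component of the second fundamental form. -/
def meanCurv (n : ℕ) (F N : Surf → MV n) (x : Surf) : ℝ :=
  (gVV n F x * mink n (pd du (pd du F) x) (N x)
    - 2 * gUV n F x * mink n (pd du (pd dv F) x) (N x)
    + gUU n F x * mink n (pd dv (pd dv F) x) (N x))
  / (2 * (gUU n F x * gVV n F x - gUV n F x ^ 2))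

/-- `N` is a unit normal field of the lift `F : Σ → E(w)`. -/
def IsUnitNormal (n : ℕ) (F N : Surf → MV n) (w : MV n) : Prop :=
  (∀ x, mink n (N x) (N x) = 1) ∧ (∀ x, mink n (N x) w = 0)
    ∧ (∀ x, mink n (N x) (F x) = 0)
    ∧ (∀ x, mink n (N x) (pd du F x) = 0) ∧ (∀ x, mink n (N x) (pd dv F x) = 0)

/-- `N` is parallel for the normal connection of `F : Σ → E(w)`: the derivative
of `N` has no component in the normal bundle of `F` in `E(w)`. -/
def ParallelNormal (n : ℕ) (F N : Surf → MV n) (w : MV n) : Prop :=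
  ∀ x e, fderiv ℝ N x e ∈ Submodule.span ℝ {F x, pd du F x, pd dv F x, w}

/-- the chart coordinates `(u,v)` are conformal curvature line coordinates
corresponding to `η`, with conformal factor `e^{2θ}`:
`I = e^{2θ}(du² + dv²)` and `η = e^{−2θ} F ∧ (−F_u du + F_v dv)`. -/
def ConformalCoords (n : ℕ) (S : IsothermicSurface n) (θ : Surf → ℝ) : Prop :=
  ContDiff ℝ (⊤ : ℕ∞) θ
  ∧ (∀ x, mink n (pd du S.F x) (pd du S.F x) = Real.exp (2 * θ x))
  ∧ (∀ x, mink n (pd dv S.F x) (pd dv S.F x) = Real.exp (2 * θ x))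
  ∧ (∀ x, mink n (pd du S.F x) (pd dv S.F x) = 0)
  ∧ (∀ x z, wedge n (S.F x) (S.W₁ x) z
      = Real.exp (-(2 * θ x)) • wedge n (S.F x) (-pd du S.F x) z)
  ∧ (∀ x z, wedge n (S.F x) (S.W₂ x) z
      = Real.exp (-(2 * θ x)) • wedge n (S.F x) (pd dv S.F x) z)

/-- the second fundamental form of the lift `F` in `E(w)` with respect to the
unit normal `N` is `II = e^{2θ}(k₁ du² + k₂ dv²)`. -/
def PrincipalCurvatures (n : ℕ) (S : IsothermicSurface n) (N : Surf → MV n)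
    (θ k₁ k₂ : Surf → ℝ) : Prop :=
  (∀ x, mink n (pd du (pd du S.F) x) (N x) = Real.exp (2 * θ x) * k₁ x)
  ∧ (∀ x, mink n (pd du (pd dv S.F) x) (N x) = 0)
  ∧ (∀ x, mink n (pd dv (pd dv S.F) x) (N x) = Real.exp (2 * θ x) * k₂ x)

/-- partial derivative of a real function on the surface -/
def pdR (e : Surf) (f : Surf → ℝ) (x : Surf) : ℝ := fderiv ℝ f x e
/-- `(Λ^c, η^c)` is the Christoffel transform of `(Λ,η)` with respect to the
pair `(v∞, v₀)`, witnessed by the stereoprojections `f`, `f^c` into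
`ℝ^n = ⟨v₀,v∞⟩^⊥`:  `F = exp(f ∧ v∞)v₀`, `F^c = exp(f^c ∧ v₀)v∞`,
`η = Ad(exp(f ∧ v∞))(df^c ∧ v₀)` and `η^c = Ad(exp(f^c ∧ v₀))(df ∧ v∞)`. -/
def IsChristoffelPair (n : ℕ) (S Sc : IsothermicSurface n) (vinf v0 : MV n)
    (f fc : Surf → MV n) : Prop :=
  vinf ∈ LightCone n ∧ v0 ∈ LightCone n ∧ mink n v0 vinf = -1
  ∧ ContDiff ℝ (⊤ : ℕ∞) f ∧ ContDiff ℝ (⊤ : ℕ∞) fc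
  ∧ (∀ x, mink n (f x) v0 = 0) ∧ (∀ x, mink n (f x) vinf = 0)
  ∧ (∀ x, mink n (fc x) v0 = 0) ∧ (∀ x, mink n (fc x) vinf = 0)
  ∧ (∀ x, S.F x = v0 + f x + (mink n (f x) (f x) / 2) • vinf)
  ∧ (∀ x, Sc.F x = vinf + fc x + (mink n (fc x) (fc x) / 2) • v0)
  ∧ (∀ x z, wedge n (S.F x) (S.W₁ x) z
      = wedge n (pd du fc x + mink n (f x) (pd du fc x) • vinf) (S.F x) z)
  ∧ (∀ x z, wedge n (S.F x) (S.W₂ x) z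
      = wedge n (pd dv fc x + mink n (f x) (pd dv fc x) • vinf) (S.F x) z)
  ∧ (∀ x z, wedge n (Sc.F x) (Sc.W₁ x) z
      = wedge n (pd du f x + mink n (fc x) (pd du f x) • v0) (Sc.F x) z)
  ∧ (∀ x z, wedge n (Sc.F x) (Sc.W₂ x) z
      = wedge n (pd dv f x + mink n (fc x) (pd dv f x) • v0) (Sc.F x) z)

/-- `Φ` is an orthogonal gauge transformation with `Φ · (d + sη) = d`. -/
def IsTGauge (n : ℕ) (S : IsothermicSurface n) (s : ℝ)
    (Φ : Surf → MV n → MV n) : Prop :=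
  (∀ x, IsLinearMap ℝ (Φ x))
  ∧ (∀ x z z', mink n (Φ x z) (Φ x z') = mink n z z')
  ∧ (∀ σ : Surf → MV n, ContDiff ℝ (⊤ : ℕ∞) σ → ∀ x,
      (fderiv ℝ (fun y => Φ y (σ y)) x du
         = Φ x (fderiv ℝ σ x du + s • wedge n (S.F x) (S.W₁ x) (σ x)))
      ∧ (fderiv ℝ (fun y => Φ y (σ y)) x dv
         = Φ x (fderiv ℝ σ x dv + s • wedge n (S.F x) (S.W₂ x) (σ x))))

/-- `(Λ_s, η_s)` is the T-transform of `(Λ,η)` associated to `Φ_s`: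
`Λ_s = Φ_s Λ` and `η_s = Ad(Φ_s) η`. -/
def IsTTransform (n : ℕ) (S : IsothermicSurface n) (s : ℝ)
    (Φ : Surf → MV n → MV n) (Ss : IsothermicSurface n) : Prop :=
  IsTGauge n S s Φ
  ∧ (∀ x, Ss.F x = Φ x (S.F x))
  ∧ (∀ x z, wedge n (Ss.F x) (Ss.W₁ x) (Φ x z) = Φ x (wedge n (S.F x) (S.W₁ x) z))
  ∧ (∀ x z, wedge n (Ss.F x) (Ss.W₂ x) (Φ x z) = Φ x (wedge n (S.F x) (S.W₂ x) z))

/-- orthogonal complement with respect to the Minkowski form -/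
def mperp (n : ℕ) (U : Submodule ℝ (MV n)) : Submodule ℝ (MV n) where
  carrier := {v | ∀ u ∈ U, mink n v u = 0}
  add_mem' := by
    intro a b ha hb u hu
    rw [mink_add_left, ha u hu, hb u hu, add_zero]
  zero_mem' := by
    intro u hu; exact mink_zero_left n u
  smul_mem' := by
    intro r a ha u hu
    rw [mink_smul_left, ha u hu, mul_zero]

/-- the spherical system of `Λ` and a Darboux transform `Λ̂ = ⟨G⟩`: the
`(n−2)`-sphere congruence `C = Λ ⊕ Λ̂ ⊕ V_R^⊥`, `V_R = Λ^{(1)} ⊕ Λ̂`. -/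
def sphericalSystem (n : ℕ) (S : IsothermicSurface n) (G : Surf → MV n)
    (x : Surf) : Submodule ℝ (MV n) :=
  Submodule.span ℝ {S.F x, G x}
    ⊔ mperp n (Submodule.span ℝ {S.F x, pd du S.F x, pd dv S.F x, G x})

/-- the sphere-planes congruence `P = C + ⟨w⟩` of `Λ` and `Λ̂ = ⟨G⟩` with
respect to `w`. -/
def spherePlanes (n : ℕ) (S : IsothermicSurface n) (G : Surf → MV n)
    (w : MV n) (x : Surf) : Submodule ℝ (MV n) :=
  sphericalSystem n S G x ⊔ Submodule.span ℝ {w}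

lemma mink_comm (n : ℕ) (a b : MV n) : mink n a b = mink n b a := by
  simp [mink, mul_comm]

lemma mink_add_right (n : ℕ) (a b c : MV n) :
    mink n a (b + c) = mink n a b + mink n a c := by
  rw [mink_comm, mink_add_left, mink_comm n b, mink_comm n c]

lemma mink_smul_right (n : ℕ) (r : ℝ) (a c : MV n) :
    mink n a (r • c) = r * mink n a c := by
  rw [mink_comm, mink_smul_left, mink_comm n c]

lemma mink_zero_right (n : ℕ) (a : MV n) : mink n a 0 = 0 := by
  rw [mink_comm, mink_zero_left]

/-- The Minkowski form as a continuous bilinear map. -/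
def minkCLM (n : ℕ) : MV n →L[ℝ] MV n →L[ℝ] ℝ :=
  LinearMap.toContinuousBilinearMap
    (LinearMap.mk₂ ℝ (mink n) (mink_add_left n) (mink_smul_left n)
      (mink_add_right n) (fun r a c => mink_smul_right n r a c))

lemma minkCLM_apply (n : ℕ) (a b : MV n) : minkCLM n a b = mink n a b := rfl

lemma hasDerivAt_mink {n : ℕ} {a b : ℝ → MV n} {a' b' : MV n} {s : ℝ}
    (ha : HasDerivAt a a' s) (hb : HasDerivAt b b' s) :
    HasDerivAt (fun y => mink n (a y) (b y)) (mink n (a s) b' + mink n a' (b s)) s :=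
  (minkCLM n).hasDerivAt_of_bilinear (fun _ => ha) (fun _ => hb)

lemma contDiff_mink {n : ℕ} {a b : Surf → MV n} (ha : ContDiff ℝ (⊤ : ℕ∞) a)
    (hb : ContDiff ℝ (⊤ : ℕ∞) b) : ContDiff ℝ (⊤ : ℕ∞) (fun y => mink n (a y) (b y)) :=
  ((minkCLM n).contDiff.comp ha).clm_apply hb

/-- The skew endomorphism `u ∧ v` as a linear map. -/
def wedgeLM (n : ℕ) (u v : MV n) : MV n →ₗ[ℝ] MV n where
  toFun := wedge n u v
  map_add' a b := by
    simp only [wedge, mink_add_right]; module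
  map_smul' r a := by
    simp only [wedge, mink_smul_right, RingHom.id_apply]; module

lemma wedgeLM_apply (n : ℕ) (u v w : MV n) : wedgeLM n u v w = wedge n u v w := rfl

/-- The coefficients of `t · c(t)`. -/
def shiftCoeff {M : Type*} [Zero M] (c : ℕ → M) : ℕ → M
  | 0 => 0
  | k + 1 => c k

lemma forall_eq_zero_of_sum_pow_smul {n N : ℕ} {c : ℕ → MV n}
    (h : ∀ t : ℝ, ∑ k ∈ Finset.range N, t ^ k • c k = 0) : ∀ k < N, c k = 0 := by
  intro k hk
  ext i
  have hP : (∑ j ∈ Finset.range N, Polynomial.monomial j (c j i) : Polynomial ℝ) = 0 := by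
    apply Polynomial.funext
    intro t
    have := congrArg (fun v : MV n => v i) (h t)
    simpa [Polynomial.eval_finsetSum, mul_comm] using this
  have := congrArg (fun P : Polynomial ℝ => P.coeff k) hP
  simpa [Polynomial.finsetSum_coeff, Polynomial.coeff_monomial, hk] using this

/-- A polynomial section is `(d + tL)`-parallel in the direction `e` for all `t` if and only if
its coefficients satisfy the corresponding recursion. -/
lemma parallel_iff_coeff {n d : ℕ} {c : ℕ → Surf → MV n} {x : Surf}
    (hc : ∀ k, DifferentiableAt ℝ (c k) x) (hd : ∀ k, d < k → c k = 0)
    (e : Surf) (L : MV n →ₗ[ℝ] MV n) :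
    (∀ t : ℝ, fderiv ℝ (fun y => ∑ k ∈ Finset.range (d + 1), t ^ k • c k y) x e
        + t • L (∑ k ∈ Finset.range (d + 1), t ^ k • c k x) = 0)
      ↔ ∀ k, fderiv ℝ (c k) x e + L (shiftCoeff c k x) = 0 := by
  have key : ∀ t : ℝ, fderiv ℝ (fun y => ∑ k ∈ Finset.range (d + 1), t ^ k • c k y) x e
        + t • L (∑ k ∈ Finset.range (d + 1), t ^ k • c k x)
      = ∑ k ∈ Finset.range (d + 2), t ^ k • (fderiv ℝ (c k) x e + L (shiftCoeff c k x)) := by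
    intro t
    have h1 : fderiv ℝ (fun y => ∑ k ∈ Finset.range (d + 1), t ^ k • c k y) x
        = ∑ k ∈ Finset.range (d + 1), t ^ k • fderiv ℝ (c k) x :=
      (HasFDerivAt.fun_sum fun k _ => (hc k).hasFDerivAt.const_smul (t ^ k)).fderiv
    simp only [smul_add, Finset.sum_add_distrib]
    rw [h1, Finset.sum_range_succ _ (d + 1), Finset.sum_range_succ' _ (d + 1),
      hd (d + 1) (Nat.lt_succ_self d)]
    simp [shiftCoeff, Finset.smul_sum, pow_succ', mul_smul]
  constructor
  · intro h k
    rcases lt_or_ge k (d + 2) with hk | hk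
    · exact forall_eq_zero_of_sum_pow_smul (fun t => (key t).symm.trans (h t)) k hk
    · obtain ⟨m, rfl⟩ : ∃ m, k = m + 1 := ⟨k - 1, by omega⟩
      simp [shiftCoeff, hd (m + 1) (by omega), hd m (by omega)]
  · intro h t
    rw [key t]
    exact Finset.sum_eq_zero fun k _ => by rw [h k, smul_zero]

/-- The `ℝ^n`-component of `exp(−f ∧ v∞) z`. -/
def flatPart (n : ℕ) (vinf v0 f z : MV n) : MV n :=
  z + mink n z v0 • vinf + mink n z vinf • v0 + mink n z vinf • f

/-- `exp(fc ∧ v₀)` applied to the combination of `v∞`, `v₀`, and `ℝ^n` components `a`, `b`, `r`. -/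
def expLift (n : ℕ) (vinf v0 fc : MV n) (a b : ℝ) (r : MV n) : MV n :=
  a • (vinf + fc + (mink n fc fc / 2) • v0) + b • v0 + r + mink n fc r • v0

lemma hasDerivAt_lift {n : ℕ} {f : ℝ → MV n} {f' : MV n} {s : ℝ} (v w : MV n)
    (hf : HasDerivAt f f' s) :
    HasDerivAt (fun y => v + f y + (mink n (f y) (f y) / 2) • w)
      (f' + mink n (f s) f' • w) s := by
  have h := (hf.const_add v).fun_add (((hasDerivAt_mink hf hf).div_const 2).smul_const w)
  refine h.congr_deriv ?_
  rw [mink_comm n f']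
  module

section Pair

variable {n : ℕ} {vinf v0 : MV n}

lemma mink_flatPart_v0 (hv0 : mink n v0 v0 = 0) (hv : mink n v0 vinf = -1) {f z : MV n}
    (hf : mink n f v0 = 0) : mink n (flatPart n vinf v0 f z) v0 = 0 := by
  simp only [flatPart, mink_add_left, mink_smul_left, mink_comm n vinf v0, hv0, hv, hf]
  ring

lemma mink_flatPart_vinf (hvinf : mink n vinf vinf = 0) (hv : mink n v0 vinf = -1) {f z : MV n}
    (hf : mink n f vinf = 0) : mink n (flatPart n vinf v0 f z) vinf = 0 := by
  simp only [flatPart, mink_add_left, mink_smul_left, hvinf, hv, hf]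
  ring

lemma mink_flatPart_of_perp {f z w : MV n}
    (hw0 : mink n w v0 = 0) (hwinf : mink n w vinf = 0) :
    mink n w (flatPart n vinf v0 f z) = mink n w z + mink n z vinf * mink n w f := by
  simp only [flatPart, mink_add_right, mink_smul_right, hw0, hwinf]
  ring

lemma mink_flatPart_self (hvinf : mink n vinf vinf = 0) (hv0 : mink n v0 v0 = 0)
    (hv : mink n v0 vinf = -1) {f : MV n} (hf0 : mink n f v0 = 0) (hfinf : mink n f vinf = 0)
    (z : MV n) :
    mink n (flatPart n vinf v0 f z) (flatPart n vinf v0 f z)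
      = mink n z z + 2 * mink n z vinf
        * mink n z (v0 + f + (mink n f f / 2) • vinf) := by
  simp only [flatPart, mink_add_right, mink_smul_right, mink_add_left, mink_smul_left, hvinf, hv0,
    hv, hf0, hfinf, mink_comm n vinf v0, mink_comm n v0 f, mink_comm n vinf f,
    mink_comm n v0 z, mink_comm n vinf z, mink_comm n f z]
  ring

lemma mink_expLift_self (hvinf : mink n vinf vinf = 0) (hv0 : mink n v0 v0 = 0)
    (hv : mink n v0 vinf = -1) {fc r : MV n} (hf0 : mink n fc v0 = 0) (hfinf : mink n fc vinf = 0)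
    (hr0 : mink n r v0 = 0) (hrinf : mink n r vinf = 0) (a b : ℝ) :
    mink n (expLift n vinf v0 fc a b r) (expLift n vinf v0 fc a b r)
      = mink n r r - 2 * a * b := by
  simp only [expLift, mink_add_right, mink_smul_right, mink_add_left, mink_smul_left, hvinf, hv0,
    hv, hf0, hfinf, mink_comm n vinf v0, mink_comm n v0 fc, mink_comm n vinf fc,
    mink_comm n v0 r, mink_comm n vinf r, hr0, hrinf, mink_comm n r fc]
  ring

lemma mink_expLift_v0 (hv0 : mink n v0 v0 = 0)
    (hv : mink n v0 vinf = -1) {fc r : MV n} (hf0 : mink n fc v0 = 0)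
    (hr0 : mink n r v0 = 0) (a b : ℝ) :
    mink n (expLift n vinf v0 fc a b r) v0 = -a := by
  simp only [expLift, mink_add_left, mink_smul_left, hv0, hf0, hr0, mink_comm n vinf v0, hv]
  ring

/-- The Christoffel connection form in a direction `w = df(e)` on an exponential lift. -/
lemma wedge_expLift (hvinf : mink n vinf vinf = 0) (hv0 : mink n v0 v0 = 0)
    (hv : mink n v0 vinf = -1) {fc r w : MV n} (hf0 : mink n fc v0 = 0)
    (hfinf : mink n fc vinf = 0) (hr0 : mink n r v0 = 0) (hrinf : mink n r vinf = 0)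
    (hw0 : mink n w v0 = 0) (hwinf : mink n w vinf = 0) (a b : ℝ) :
    wedge n (w + mink n fc w • v0) (vinf + fc + (mink n fc fc / 2) • v0)
        (expLift n vinf v0 fc a b r)
      = mink n w r • (vinf + fc + (mink n fc fc / 2) • v0) + b • (w + mink n fc w • v0) := by
  simp only [wedge, expLift, mink_add_right, mink_smul_right, mink_add_left, mink_smul_left, hvinf,
    hv0, hv, hf0, hfinf, mink_comm n vinf v0, mink_comm n v0 fc, mink_comm n vinf fc,
    mink_comm n v0 r, mink_comm n vinf r, hr0, hrinf, hw0, hwinf, mink_comm n w fc]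
  module

/-- The Christoffel gauge transform of the coefficient recursion along a curve. -/
lemma hasDerivAt_expLift_flatPart (hvinf : mink n vinf vinf = 0) (hv0 : mink n v0 v0 = 0)
    (hv : mink n v0 vinf = -1) {f fc z zprev znext : ℝ → MV n} {f' fc' w : MV n} {s : ℝ}
    (hf : HasDerivAt f f' s) (hfc : HasDerivAt fc fc' s)
    (hf0 : mink n (f s) v0 = 0) (hfinf : mink n (f s) vinf = 0)
    (hf0' : mink n f' v0 = 0) (hfinf' : mink n f' vinf = 0)
    (hfc0' : mink n fc' v0 = 0) (hfcinf' : mink n fc' vinf = 0)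
    (hz : HasDerivAt z
      (-wedge n (fc' + mink n (f s) fc' • vinf)
        (v0 + f s + (mink n (f s) (f s) / 2) • vinf) (zprev s)) s)
    (hzprev : HasDerivAt zprev
      (-wedge n (fc' + mink n (f s) fc' • vinf)
        (v0 + f s + (mink n (f s) (f s) / 2) • vinf) w) s)
    (hznext : HasDerivAt znext
      (-wedge n (fc' + mink n (f s) fc' • vinf)
        (v0 + f s + (mink n (f s) (f s) / 2) • vinf) (z s)) s) :
    HasDerivAt
      (fun y => expLift n vinf v0 (fc y)
        (-mink n (zprev y) (v0 + f y + (mink n (f y) (f y) / 2) • vinf))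
        (-mink n (znext y) vinf) (flatPart n vinf v0 (f y) (z y)))
      (-(mink n f' (flatPart n vinf v0 (f s) (zprev s))
          • (vinf + fc s + (mink n (fc s) (fc s) / 2) • v0)
        + (-mink n (z s) vinf) • (f' + mink n (fc s) f' • v0))) s := by
  have ha : HasDerivAt
      (fun y => -mink n (zprev y) (v0 + f y + (mink n (f y) (f y) / 2) • vinf))
      (-mink n f' (flatPart n vinf v0 (f s) (zprev s))) s := by
    refine HasDerivAt.congr_deriv ((hasDerivAt_mink hzprev (hasDerivAt_lift v0 vinf hf)).fun_neg) ?_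
    rw [mink_flatPart_of_perp hf0' hfinf', ← neg_one_smul ℝ (wedge _ _ _ _)]
    simp only [wedge, sub_eq_add_neg, ← neg_smul, mink_add_left, mink_add_right, mink_smul_left,
      mink_smul_right, hvinf, hv0, hv, hf0, hfinf, hfc0', hfcinf', mink_comm n vinf v0,
      mink_comm n v0 (f s), mink_comm n vinf (f s), mink_comm n fc' (f s),
      mink_comm n (zprev s) f', mink_comm n f' (f s)]
    ring
  have hb : HasDerivAt (fun y => -mink n (znext y) vinf)
      (-mink n fc' (flatPart n vinf v0 (f s) (z s))) s := by
    refine HasDerivAt.congr_deriv ((hasDerivAt_mink hznext (hasDerivAt_const s vinf)).fun_neg) ?_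
    rw [mink_flatPart_of_perp hfc0' hfcinf', ← neg_one_smul ℝ (wedge _ _ _ _)]
    simp only [wedge, sub_eq_add_neg, ← neg_smul, mink_add_left, mink_smul_left, hvinf, hv,
      hfinf, hfcinf', mink_comm n (z s) _, mink_comm n fc' (f s), mink_zero_right]
    ring
  have hr : HasDerivAt (fun y => flatPart n vinf v0 (f y) (z y))
      (mink n (z s) vinf • f'
        + mink n (zprev s) (v0 + f s + (mink n (f s) (f s) / 2) • vinf) • fc') s := by
    have hv0' := hasDerivAt_mink hz (hasDerivAt_const s v0)
    have hvinf' := hasDerivAt_mink hz (hasDerivAt_const s vinf)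
    refine HasDerivAt.congr_deriv (((hz.fun_add (hv0'.smul_const vinf)).fun_add (hvinf'.smul_const v0)).fun_add
      (hvinf'.fun_smul hf)) ?_
    rw [← neg_one_smul ℝ (wedge _ _ _ _)]
    simp only [wedge, sub_eq_add_neg, ← neg_smul, mink_add_left, mink_add_right, mink_smul_left,
      mink_smul_right, hvinf, hv0, hv, hf0, hfinf, hfc0', hfcinf', mink_comm n vinf v0,
      mink_comm n v0 (zprev s), mink_comm n vinf (zprev s), mink_comm n (f s) (zprev s),
      mink_zero_right]
    module
  have h := (((ha.fun_smul (hasDerivAt_lift vinf v0 hfc)).fun_add (hb.smul_const v0)).fun_add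
    hr).fun_add ((hasDerivAt_mink hfc hr).smul_const v0)
  refine h.congr_deriv ?_
  simp only [mink_add_right, mink_smul_right]
  module

lemma hasDerivAt_line {g : Surf → MV n} {x : Surf} (hg : DifferentiableAt ℝ g x) (e : Surf) :
    HasDerivAt (fun s : ℝ => g (x + s • e)) (fderiv ℝ g x e) 0 :=
  hg.hasFDerivAt.hasLineDerivAt e

lemma mink_fderiv_eq_zero {g : Surf → MV n} {x : Surf} {v : MV n}
    (hg : DifferentiableAt ℝ g x) (h : ∀ y, mink n (g y) v = 0) (e : Surf) :
    mink n (fderiv ℝ g x e) v = 0 := by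
  have h1 := hasDerivAt_mink (hasDerivAt_line hg e) (hasDerivAt_const (0 : ℝ) v)
  simp only [h, mink_zero_right, zero_smul, add_zero, zero_add] at h1
  exact h1.unique (hasDerivAt_const (0 : ℝ) (0 : ℝ))

lemma fderiv_lift {f : Surf → MV n} {x : Surf} (hf : DifferentiableAt ℝ f x)
    {F : Surf → MV n} (hF : DifferentiableAt ℝ F x) {v w : MV n}
    (h : ∀ y, F y = v + f y + (mink n (f y) (f y) / 2) • w) (e : Surf) :
    fderiv ℝ F x e = fderiv ℝ f x e + mink n (f x) (fderiv ℝ f x e) • w := by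
  have h1 := hasDerivAt_lift v w (hasDerivAt_line hf e)
  simp only [← h, zero_smul, add_zero] at h1
  exact (hasDerivAt_line hF e).unique h1

/-- The coefficients of the Christoffel gauge transform `Γᶜ(t) p(t)`. -/
def christoffelCoeff (vinf v0 : MV n) (f fc : Surf → MV n) (p : ℕ → Surf → MV n) (k : ℕ)
    (y : Surf) : MV n :=
  expLift n vinf v0 (fc y)
    (-mink n (shiftCoeff p k y) (v0 + f y + (mink n (f y) (f y) / 2) • vinf))
    (-mink n (p (k + 1) y) vinf) (flatPart n vinf v0 (f y) (p k y))

lemma contDiff_shiftCoeff {p : ℕ → Surf → MV n} (hp : ∀ k, ContDiff ℝ (⊤ : ℕ∞) (p k)) :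
    ∀ k, ContDiff ℝ (⊤ : ℕ∞) (shiftCoeff p k)
  | 0 => contDiff_const
  | k + 1 => hp k

lemma contDiff_christoffelCoeff (vinf v0 : MV n) {f fc : Surf → MV n}
    {p : ℕ → Surf → MV n} (hf : ContDiff ℝ (⊤ : ℕ∞) f) (hfc : ContDiff ℝ (⊤ : ℕ∞) fc)
    (hp : ∀ k, ContDiff ℝ (⊤ : ℕ∞) (p k)) (k : ℕ) :
    ContDiff ℝ (⊤ : ℕ∞) (christoffelCoeff vinf v0 f fc p k) := by
  have hc : ∀ v : MV n, ContDiff ℝ (⊤ : ℕ∞) (fun _ : Surf => v) := fun _ => contDiff_const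
  have hlift : ∀ {g : Surf → MV n} (v w : MV n), ContDiff ℝ (⊤ : ℕ∞) g →
      ContDiff ℝ (⊤ : ℕ∞) (fun y => v + g y + (mink n (g y) (g y) / 2) • w) :=
    fun v w hg => ((hc v).add hg).add (((contDiff_mink hg hg).div_const 2).smul (hc w))
  have hflat : ContDiff ℝ (⊤ : ℕ∞) (fun y => flatPart n vinf v0 (f y) (p k y)) :=
    (((hp k).add ((contDiff_mink (hp k) (hc v0)).smul (hc vinf))).add
      ((contDiff_mink (hp k) (hc vinf)).smul (hc v0))).add
      ((contDiff_mink (hp k) (hc vinf)).smul hf)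
  exact ((((contDiff_mink (contDiff_shiftCoeff hp k) (hlift v0 vinf hf)).neg.smul
    (hlift vinf v0 hfc)).add ((contDiff_mink (hp (k + 1)) (hc vinf)).neg.smul (hc v0))).add
    hflat).add ((contDiff_mink hfc hflat).smul (hc v0))

lemma christoffelCoeff_recursion (hvinf : mink n vinf vinf = 0) (hv0 : mink n v0 v0 = 0)
    (hv : mink n v0 vinf = -1) {f fc : Surf → MV n} {p : ℕ → Surf → MV n}
    (hf : ContDiff ℝ (⊤ : ℕ∞) f) (hfc : ContDiff ℝ (⊤ : ℕ∞) fc)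
    (hf0 : ∀ y, mink n (f y) v0 = 0) (hfinf : ∀ y, mink n (f y) vinf = 0)
    (hfc0 : ∀ y, mink n (fc y) v0 = 0) (hfcinf : ∀ y, mink n (fc y) vinf = 0)
    (hp : ∀ k, ContDiff ℝ (⊤ : ℕ∞) (p k)) {x e : Surf}
    (h0 : mink n (p 0 x) vinf = 0)
    (hrec : ∀ k, fderiv ℝ (p k) x e
      + wedge n (fderiv ℝ fc x e + mink n (f x) (fderiv ℝ fc x e) • vinf)
        (v0 + f x + (mink n (f x) (f x) / 2) • vinf) (shiftCoeff p k x) = 0) (k : ℕ) :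
    fderiv ℝ (christoffelCoeff vinf v0 f fc p k) x e
      + wedge n (fderiv ℝ f x e + mink n (fc x) (fderiv ℝ f x e) • v0)
        (vinf + fc x + (mink n (fc x) (fc x) / 2) • v0)
        (shiftCoeff (christoffelCoeff vinf v0 f fc p) k x) = 0 := by
  have hdiff : ∀ {g : Surf → MV n}, ContDiff ℝ (⊤ : ℕ∞) g → DifferentiableAt ℝ g x :=
    fun hg => hg.differentiable (by simp) x
  have hp' : ∀ k, HasDerivAt (fun s : ℝ => p k (x + s • e))
      (-wedge n (fderiv ℝ fc x e + mink n (f x) (fderiv ℝ fc x e) • vinf)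
        (v0 + f x + (mink n (f x) (f x) / 2) • vinf) (shiftCoeff p k x)) 0 := fun k =>
    (hasDerivAt_line (hdiff (hp k)) e).congr_deriv (eq_neg_of_add_eq_zero_left (hrec k))
  have hprev : HasDerivAt (fun s : ℝ => shiftCoeff p k (x + s • e))
      (-wedge n (fderiv ℝ fc x e + mink n (f x) (fderiv ℝ fc x e) • vinf)
        (v0 + f x + (mink n (f x) (f x) / 2) • vinf) (shiftCoeff (shiftCoeff p) k x)) 0 := by
    cases k with
    | zero =>
      refine (hasDerivAt_const (0 : ℝ) (0 : MV n)).congr_deriv ?_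
      rw [← wedgeLM_apply]
      simp [shiftCoeff]
    | succ k =>
      cases k with
      | zero => exact hp' 0
      | succ k => exact hp' (k + 1)
  have hf' := hasDerivAt_line (hdiff hf) e
  have hfc' := hasDerivAt_line (hdiff hfc) e
  have hf0' := mink_fderiv_eq_zero (hdiff hf) hf0 e
  have hfinf' := mink_fderiv_eq_zero (hdiff hf) hfinf e
  have key := hasDerivAt_expLift_flatPart (s := 0)
    (f := fun s : ℝ => f (x + s • e)) (fc := fun s : ℝ => fc (x + s • e))
    (z := fun s : ℝ => p k (x + s • e)) (zprev := fun s : ℝ => shiftCoeff p k (x + s • e))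
    (znext := fun s : ℝ => p (k + 1) (x + s • e)) (w := shiftCoeff (shiftCoeff p) k x)
    hvinf hv0 hv hf' hfc' (hf0 _) (hfinf _) hf0' hfinf'
    (mink_fderiv_eq_zero (hdiff hfc) hfc0 e) (mink_fderiv_eq_zero (hdiff hfc) hfcinf e)
    (by simpa only [zero_smul, add_zero] using hp' k)
    (by simpa only [zero_smul, add_zero] using hprev)
    (by simpa only [zero_smul, add_zero, shiftCoeff] using hp' (k + 1))
  simp only [zero_smul, add_zero] at key
  rw [(hasDerivAt_line (hdiff (contDiff_christoffelCoeff vinf v0 hf hfc hp k)) e).unique key,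
    neg_add_eq_zero]
  cases k with
  | zero =>
    simp only [shiftCoeff, Pi.zero_apply, h0]
    rw [← wedgeLM_apply, map_zero, mink_flatPart_of_perp hf0' hfinf', mink_zero_right,
      mink_zero_left]
    simp
  | succ k =>
    exact (wedge_expLift hvinf hv0 hv (hfc0 x) (hfcinf x) (mink_flatPart_v0 hv0 hv (hf0 x))
      (mink_flatPart_vinf hvinf hv (hfinf x)) hf0' hfinf' _ _).symm

/-- A vector annihilated by `η` in a direction in which `η` does not vanish is orthogonal to `F`. -/
lemma mink_eq_zero_of_wedge_eq_zero (hvinf : mink n vinf vinf = 0) (hv : mink n v0 vinf = -1)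
    {f w z : MV n} (hfinf : mink n f vinf = 0) (hw0 : mink n w v0 = 0)
    (hwinf : mink n w vinf = 0) (hw : w ≠ 0) (c : ℝ)
    (h : wedge n (w + c • vinf) (v0 + f + (mink n f f / 2) • vinf) z = 0) :
    mink n z (v0 + f + (mink n f f / 2) • vinf) = 0 := by
  have hA : mink n (w + c • vinf) vinf = 0 := by
    rw [mink_add_left, mink_smul_left, hwinf, hvinf]; ring
  have hF : mink n (v0 + f + (mink n f f / 2) • vinf) vinf = -1 := by
    simp only [mink_add_left, mink_smul_left, hv, hvinf, hfinf]; ring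
  have hA0 : w + c • vinf ≠ 0 := by
    intro h0
    have h1 := congrArg (fun u => mink n u v0) h0
    simp only [mink_add_left, mink_smul_left, hw0, mink_comm n vinf v0, hv, mink_zero_left] at h1
    obtain rfl : c = 0 := by linarith
    exact hw (by simpa using h0)
  generalize w + c • vinf = A at *
  generalize v0 + f + (mink n f f / 2) • vinf = F at *
  have h1 := congrArg (fun u => mink n u vinf) h
  simp only [wedge, sub_eq_add_neg, ← neg_smul, mink_add_left, mink_smul_left, hA, hF,
    mink_zero_left] at h1
  have h2 : mink n A z = 0 := by linarith
  rw [wedge, h2, zero_smul, zero_sub, neg_eq_zero] at h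
  rw [mink_comm]
  exact (smul_eq_zero.mp h).resolve_right hA0

/-- If the top coefficient of the transform vanishes, then the vector spans the light line. -/
lemma eq_smul_lift_of_flatPart_eq_zero {f z : MV n}
    (h : flatPart n vinf v0 f z = 0)
    (hf0 : mink n f v0 = 0) (hfinf : mink n f vinf = 0)
    (hF : mink n z (v0 + f + (mink n f f / 2) • vinf) = 0) :
    z = (-mink n z vinf) • (v0 + f + (mink n f f / 2) • vinf) := by
  have h1 := mink_flatPart_of_perp (z := z) (f := f) hf0 hfinf
  rw [h, mink_zero_right] at h1
  simp only [mink_add_right, mink_smul_right] at hF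
  rw [mink_comm n z f] at hF
  have h2 : mink n z v0 = mink n z vinf * mink n f f / 2 := by linarith
  rw [flatPart, h2] at h
  linear_combination (norm := module) h

lemma eq_zero_of_expLift_eq_zero (hv0 : mink n v0 v0 = 0)
    (hv : mink n v0 vinf = -1) {fc r : MV n} (hfc0 : mink n fc v0 = 0)
    (hr0 : mink n r v0 = 0) (hrinf : mink n r vinf = 0) {a b : ℝ}
    (h : expLift n vinf v0 fc a b r = 0) : a = 0 ∧ r = 0 := by
  have ha : a = 0 := by
    have := mink_expLift_v0 (a := a) (b := b) hv0 hv hfc0 hr0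
    rw [h, mink_zero_left] at this
    linarith
  refine ⟨ha, ?_⟩
  subst ha
  have h1 : r + (b + mink n fc r) • v0 = 0 := by
    rw [← h, expLift]; module
  have h2 := congrArg (fun u => mink n u vinf) h1
  simp only [mink_add_left, mink_smul_left, hrinf, hv, mink_zero_left] at h2
  have h3 : b + mink n fc r = 0 := by linarith
  simpa [h3] using h1

end Pair

lemma sum_pow_smul_shiftCoeff {M : Type*} [AddCommGroup M] [Module ℝ M] {d : ℕ} {a : ℕ → M}
    (ha : a d = 0) (t : ℝ) :
    ∑ k ∈ Finset.range (d + 1), t ^ k • shiftCoeff a k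
      = t • ∑ k ∈ Finset.range (d + 1), t ^ k • a k := by
  rw [Finset.sum_range_succ', Finset.sum_range_succ, ha]
  simp [shiftCoeff, Finset.smul_sum, pow_succ', mul_smul]

lemma smul_sum_pow_smul_succ {M : Type*} [AddCommGroup M] [Module ℝ M] {d : ℕ} {b : ℕ → M}
    (h0 : b 0 = 0) (hd : b (d + 1) = 0) (t : ℝ) :
    t • ∑ k ∈ Finset.range (d + 1), t ^ k • b (k + 1)
      = ∑ k ∈ Finset.range (d + 1), t ^ k • b k := by
  rw [Finset.sum_range_succ, Finset.sum_range_succ' _ d, hd, h0]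
  simp [Finset.smul_sum, pow_succ', mul_smul]

/-- `flatPart` as a linear map in its last argument. -/
def flatPartLM (n : ℕ) (vinf v0 f : MV n) : MV n →ₗ[ℝ] MV n where
  toFun := flatPart n vinf v0 f
  map_add' a b := by
    simp only [flatPart, mink_add_left]; module
  map_smul' r a := by
    simp only [flatPart, mink_smul_left, RingHom.id_apply]; module

lemma flatPartLM_apply (n : ℕ) (vinf v0 f z : MV n) :
    flatPartLM n vinf v0 f z = flatPart n vinf v0 f z := rfl

/-- `expLift` as a linear map. -/
def expLiftLM (n : ℕ) (vinf v0 fc : MV n) : ℝ × ℝ × MV n →ₗ[ℝ] MV n where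
  toFun z := expLift n vinf v0 fc z.1 z.2.1 z.2.2
  map_add' a b := by
    simp only [expLift, mink_add_right, Prod.fst_add, Prod.snd_add]; module
  map_smul' r a := by
    simp only [expLift, mink_smul_right, RingHom.id_apply, Prod.smul_fst, Prod.smul_snd,
      smul_eq_mul]; module

lemma sum_pow_smul_expLift {n d : ℕ} (vinf v0 fc : MV n) (a b : ℕ → ℝ) (r : ℕ → MV n) (t : ℝ) :
    ∑ k ∈ Finset.range (d + 1), t ^ k • expLift n vinf v0 fc (a k) (b k) (r k)
      = expLift n vinf v0 fc (∑ k ∈ Finset.range (d + 1), t ^ k • a k)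
        (∑ k ∈ Finset.range (d + 1), t ^ k • b k) (∑ k ∈ Finset.range (d + 1), t ^ k • r k) := by
  have h := map_sum (expLiftLM n vinf v0 fc) (fun k => t ^ k • ((a k, b k, r k) : ℝ × ℝ × MV n))
    (Finset.range (d + 1))
  simp only [map_smul] at h
  simp only [expLiftLM, LinearMap.coe_mk, AddHom.coe_mk, Prod.fst_sum, Prod.snd_sum,
    Prod.smul_fst, Prod.smul_snd] at h
  exact h.symm

lemma mink_sum_pow_smul_left {n d : ℕ} (z : ℕ → MV n) (w : MV n) (t : ℝ) :
    ∑ k ∈ Finset.range (d + 1), t ^ k • -mink n (z k) w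
      = -mink n (∑ k ∈ Finset.range (d + 1), t ^ k • z k) w := by
  have h := map_sum ((minkCLM n).flip w) (fun k => t ^ k • z k) (Finset.range (d + 1))
  simp only [map_smul, ContinuousLinearMap.flip_apply, minkCLM_apply] at h
  rw [h]
  simp

/-- The Christoffel gauge transform preserves the norm polynomial. -/
lemma mink_sum_christoffelCoeff {n d : ℕ} {vinf v0 : MV n} (hvinf : mink n vinf vinf = 0)
    (hv0 : mink n v0 v0 = 0) (hv : mink n v0 vinf = -1) {f fc : Surf → MV n}
    {p : ℕ → Surf → MV n} {x : Surf}
    (hf0 : mink n (f x) v0 = 0) (hfinf : mink n (f x) vinf = 0)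
    (hfc0 : mink n (fc x) v0 = 0) (hfcinf : mink n (fc x) vinf = 0)
    (h0 : mink n (p 0 x) vinf = 0) (hd : p (d + 1) x = 0)
    (htop : mink n (p d x) (v0 + f x + (mink n (f x) (f x) / 2) • vinf) = 0) (t : ℝ) :
    mink n (∑ k ∈ Finset.range (d + 1), t ^ k • christoffelCoeff vinf v0 f fc p k x)
        (∑ k ∈ Finset.range (d + 1), t ^ k • christoffelCoeff vinf v0 f fc p k x)
      = mink n (∑ k ∈ Finset.range (d + 1), t ^ k • p k x)
          (∑ k ∈ Finset.range (d + 1), t ^ k • p k x) := by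
  set F := v0 + f x + (mink n (f x) (f x) / 2) • vinf with hF
  set P := ∑ k ∈ Finset.range (d + 1), t ^ k • p k x with hP
  have hr : ∑ k ∈ Finset.range (d + 1), t ^ k • flatPart n vinf v0 (f x) (p k x)
      = flatPart n vinf v0 (f x) P := by
    simp only [hP, ← flatPartLM_apply, map_sum, map_smul]
  have ha : ∑ k ∈ Finset.range (d + 1), t ^ k • -mink n (shiftCoeff p k x) F
      = t * -mink n P F := by
    rw [hP, ← mink_sum_pow_smul_left, ← smul_eq_mul,
      ← sum_pow_smul_shiftCoeff (a := fun k => -mink n (p k x) F) (by simp [htop])]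
    refine Finset.sum_congr rfl fun k _ => ?_
    cases k <;> simp [shiftCoeff, mink_zero_left]
  have hb : t * ∑ k ∈ Finset.range (d + 1), t ^ k • -mink n (p (k + 1) x) vinf
      = -mink n P vinf := by
    rw [hP, ← mink_sum_pow_smul_left, ← smul_eq_mul]
    exact smul_sum_pow_smul_succ (b := fun k => -mink n (p k x) vinf) (by simp [h0])
      (by simp [hd, mink_zero_left]) t
  simp only [christoffelCoeff, sum_pow_smul_expLift]
  rw [hr, mink_expLift_self hvinf hv0 hv hfc0 hfcinf (mink_flatPart_v0 hv0 hv hf0)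
    (mink_flatPart_vinf hvinf hv hfinf), ha, mink_flatPart_self hvinf hv0 hv hf0 hfinf]
  linear_combination (2 * mink n P F) * hb

lemma christoffelCoeff_eq_zero {n d : ℕ} {vinf v0 : MV n} {f fc : Surf → MV n}
    {p : ℕ → Surf → MV n} (hd : ∀ k, d < k → p k = 0)
    (htop : ∀ x, mink n (p d x) (v0 + f x + (mink n (f x) (f x) / 2) • vinf) = 0) (k : ℕ)
    (hk : d < k) : christoffelCoeff vinf v0 f fc p k = 0 := by
  funext x
  have h1 : mink n (shiftCoeff p k x) (v0 + f x + (mink n (f x) (f x) / 2) • vinf) = 0 := by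
    obtain ⟨m, rfl⟩ : ∃ m, k = m + 1 := ⟨k - 1, by omega⟩
    rcases (Nat.lt_succ_iff.mp hk).eq_or_lt with rfl | hm
    · exact htop x
    · simp [shiftCoeff, hd m hm, mink_zero_left]
  rw [christoffelCoeff, h1, hd k hk, hd (k + 1) (by omega)]
  simp [flatPart, expLift, mink_zero_left, mink_zero_right]

/-- Theorem: if `(Λ,η)` is special isothermic of type `d` with `p(0) ⊥ v∞`,
then its Christoffel transform is special isothermic of type `d` with respect
to a `q(t)` with `(q(t),q(t)) = (p(t),p(t))` and `q(0) ⊥ v₀`; moreover if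
`p(0) ∈ ⟨v∞⟩` then `q(0) ∈ ⟨v₀⟩`. -/
theorem christoffel_transform_special (n d : ℕ)
    (S Sc : IsothermicSurface n) (vinf v0 : MV n) (f fc : Surf → MV n)
    (hC : IsChristoffelPair n S Sc vinf v0 f fc)
    (p : PolyConservedQuantity n S d)
    (h0 : ∀ x, mink n (p.coeff 0 x) vinf = 0) :
    ∃ q : PolyConservedQuantity n Sc d,
      (∀ t x, mink n (pcEval q t x) (pcEval q t x)
          = mink n (pcEval p t x) (pcEval p t x))
      ∧ (∀ x, mink n (q.coeff 0 x) v0 = 0)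
      ∧ ((∀ x, p.coeff 0 x ∈ Submodule.span ℝ {vinf}) →
          ∀ x, q.coeff 0 x ∈ Submodule.span ℝ {v0}) := by
  obtain ⟨hvinf, hv0, hv, hf, hfc, hf0, hfinf, hfc0, hfcinf, hF, hFc, hW₁, hW₂, hWc₁, hWc₂⟩ := hC
  replace hvinf := hvinf.2
  replace hv0 := hv0.2
  have hdiff : ∀ {g : Surf → MV n} {x : Surf}, ContDiff ℝ (⊤ : ℕ∞) g → DifferentiableAt ℝ g x :=
    fun hg => hg.differentiable (by simp) _
  have hrec₁ : ∀ x k, fderiv ℝ (p.coeff k) x du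
      + wedge n (fderiv ℝ fc x du + mink n (f x) (fderiv ℝ fc x du) • vinf)
        (v0 + f x + (mink n (f x) (f x) / 2) • vinf) (shiftCoeff p.coeff k x) = 0 := by
    intro x k
    rw [← hF]
    have h := (parallel_iff_coeff (x := x) (fun k => hdiff (p.smooth k)) p.coeff_eq_zero du
      (wedgeLM n (S.F x) (S.W₁ x))).mp (fun t => (p.conserved t x).1) k
    rwa [wedgeLM_apply, hW₁] at h
  have hrec₂ : ∀ x k, fderiv ℝ (p.coeff k) x dv
      + wedge n (fderiv ℝ fc x dv + mink n (f x) (fderiv ℝ fc x dv) • vinf)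
        (v0 + f x + (mink n (f x) (f x) / 2) • vinf) (shiftCoeff p.coeff k x) = 0 := by
    intro x k
    rw [← hF]
    have h := (parallel_iff_coeff (x := x) (fun k => hdiff (p.smooth k)) p.coeff_eq_zero dv
      (wedgeLM n (S.F x) (S.W₂ x))).mp (fun t => (p.conserved t x).2) k
    rwa [wedgeLM_apply, hW₂] at h
  have hfc_ne : ∀ x, fderiv ℝ fc x du ≠ 0 := by
    intro x h
    have h1 : pd du Sc.F x ≠ 0 := (Sc.immersed x).ne_zero 1
    rw [pd, fderiv_lift (hdiff hfc) (hdiff Sc.smooth_F) hFc, h, mink_zero_right] at h1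
    simp at h1
  have htop : ∀ x, mink n (p.coeff d x)
      (v0 + f x + (mink n (f x) (f x) / 2) • vinf) = 0 := by
    intro x
    refine mink_eq_zero_of_wedge_eq_zero hvinf hv (hfinf x)
      (mink_fderiv_eq_zero (hdiff hfc) hfc0 du) (mink_fderiv_eq_zero (hdiff hfc) hfcinf du)
      (hfc_ne x) (mink n (f x) (fderiv ℝ fc x du)) ?_
    have h := hrec₁ x (d + 1)
    rw [p.coeff_eq_zero _ (Nat.lt_succ_self d)] at h
    simpa [shiftCoeff] using h
  have hsmooth := contDiff_christoffelCoeff vinf v0 hf hfc p.smooth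
  have hvanish := christoffelCoeff_eq_zero (fc := fc) p.coeff_eq_zero htop
  refine ⟨⟨christoffelCoeff vinf v0 f fc p.coeff, hsmooth, hvanish, ?_, ?_⟩, ?_, ?_, ?_⟩
  · intro hq
    apply p.top_ne
    have hflat : ∀ x, mink n (shiftCoeff p.coeff d x) (S.F x) = 0
        ∧ p.coeff d x = (-mink n (p.coeff d x) vinf) • S.F x := by
      intro x
      obtain ⟨h1, h2⟩ := eq_zero_of_expLift_eq_zero hv0 hv (hfc0 x)
        (mink_flatPart_v0 hv0 hv (hf0 x)) (mink_flatPart_vinf hvinf hv (hfinf x)) (congrFun hq x)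
      rw [hF]
      exact ⟨neg_eq_zero.mp h1, eq_smul_lift_of_flatPart_eq_zero h2 (hf0 x) (hfinf x) (htop x)⟩
    funext x
    have h1 := hasDerivAt_line (hdiff (p.smooth d)) du (x := x)
    have h2 := (hasDerivAt_mink h1 (hasDerivAt_const (0 : ℝ) vinf)).fun_neg.fun_smul
      (hasDerivAt_line (hdiff S.smooth_F) du (x := x))
    simp only [← (hflat _).2] at h2
    have h3 := h1.unique h2
    rw [eq_neg_of_add_eq_zero_left (hrec₁ x d), ← hF, wedge, mink_comm n (S.F x),
      (hflat x).1] at h3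
    simp only [zero_smul, add_zero, sub_zero] at h3
    generalize mink n (fderiv ℝ fc x du + mink n (f x) (fderiv ℝ fc x du) • vinf)
      (shiftCoeff p.coeff d x) = a at h3
    generalize mink n (p.coeff d x) 0 + mink n (-(a • S.F x)) vinf = b at h3
    have hb : -mink n (p.coeff d x) vinf = 0 := by
      refine Fintype.linearIndependent_iff.mp (S.immersed x)
        ![a - b, -mink n (p.coeff d x) vinf, 0] ?_ 1
      simp only [Fin.sum_univ_three, Matrix.cons_val, pd]
      linear_combination (norm := module) -h3
    rw [(hflat x).2, hb, zero_smul, Pi.zero_apply]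
  · intro t x
    constructor
    · refine (parallel_iff_coeff (x := x) (fun k => hdiff (hsmooth k)) hvanish du
        (wedgeLM n (Sc.F x) (Sc.W₁ x))).mpr (fun k => ?_) t
      rw [wedgeLM_apply, hWc₁, hFc]
      exact christoffelCoeff_recursion hvinf hv0 hv hf hfc hf0 hfinf hfc0 hfcinf p.smooth (h0 x)
        (hrec₁ x) k
    · refine (parallel_iff_coeff (x := x) (fun k => hdiff (hsmooth k)) hvanish dv
        (wedgeLM n (Sc.F x) (Sc.W₂ x))).mpr (fun k => ?_) t
      rw [wedgeLM_apply, hWc₂, hFc]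
      exact christoffelCoeff_recursion hvinf hv0 hv hf hfc hf0 hfinf hfc0 hfcinf p.smooth (h0 x)
        (hrec₂ x) k
  · intro t x
    exact mink_sum_christoffelCoeff hvinf hv0 hv (hf0 x) (hfinf x) (hfc0 x) (hfcinf x) (h0 x)
      (by rw [p.coeff_eq_zero _ (Nat.lt_succ_self d)]; rfl) (htop x) t
  · intro x
    refine (mink_expLift_v0 hv0 hv (hfc0 x) (mink_flatPart_v0 hv0 hv (hf0 x)) _ _).trans ?_
    simp [shiftCoeff, mink_zero_left]
  · intro h x
    obtain ⟨c, hc⟩ := Submodule.mem_span_singleton.mp (h x)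
    have hr : flatPart n vinf v0 (f x) (p.coeff 0 x) = 0 := by
      rw [← hc]
      simp only [flatPart, mink_smul_left, hvinf, mink_comm n vinf v0, hv]
      module
    refine Submodule.mem_span_singleton.mpr ⟨-mink n (p.coeff 1 x) vinf, ?_⟩
    simp [christoffelCoeff, shiftCoeff, mink_zero_left, mink_zero_right, expLift, hr]
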